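/- Let H be the real Hilbert space ℓ² of square-summable real sequences with its Borel σ-algebra, and let ν₁ and ν₂ be Lévy measures on H. Then there exists a unique pair (ν⁺, ν⁻) of mutually singular Lévy measures on H such that ν⁺(B) − ν⁻(B) = ν₁(B) − ν₂(B) for every Borel set B ⊆ H satisfying B ∩ {x ∈ H : ‖x‖ < r} = ∅ for some r > 0. -/

import Mathlib

open MeasureTheory Set

/-- The real Hilbert space `ℓ²` of square-summable real sequences. -/
abbrev SeqL2 : Type := lp (fun _ : ℕ => ℝ) 2

noncomputable instance : MeasurableSpace SeqL2 := borel _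

instance : BorelSpace SeqL2 := ⟨rfl⟩

/-- A Lévy measure on `ℓ²`: a Borel measure `ν` with `ν {0} = 0` and
`∫ min(1, ‖x‖²) ν(dx) < ∞`. -/
def IsLevyMeasureL2 (ν : Measure SeqL2) : Prop :=
  ν {0} = 0 ∧ ∫⁻ x, ENNReal.ofReal (min 1 (‖x‖ ^ 2)) ∂ν < ⊤

/-- A set `B ⊆ ℓ²` is bounded away from zero if `B ∩ {x : ‖x‖ < r} = ∅` for some `r > 0`. -/
def BoundedAwayFromZeroL2 (B : Set SeqL2) : Prop :=
  ∃ r > (0 : ℝ), B ∩ {x : SeqL2 | ‖x‖ < r} = ∅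

/-- A part of a mutually singular pair is minimal among all pairs with the same difference. -/
theorem MeasureTheory.Measure.MutuallySingular.le_of_add_eq_add {α : Type*} [MeasurableSpace α]
    {p q p' q' : Measure α} (h : p ⟂ₘ q) (heq : p + q' = p' + q) : p ≤ p' := by
  obtain ⟨s, hs, hps, hqs⟩ := h
  refine Measure.le_iff.2 fun A _ => ?_
  calc p A = p (A \ s) := (measure_sdiff_null hps).symm
    _ ≤ (p + q') (A \ s) := by simp
    _ = p' (A \ s) + q (A \ s) := by rw [heq, Measure.add_apply]
    _ = p' (A \ s) := by
      rw [measure_mono_null (fun x hx => hx.2 : A \ s ⊆ sᶜ) hqs, add_zero]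
    _ ≤ p' A := measure_mono sdiff_subset

/-- The difference of two σ-finite measures is represented by a mutually singular pair. -/
theorem MeasureTheory.Measure.exists_mutuallySingular_add_eq_add {α : Type*} [MeasurableSpace α]
    (μ ν : Measure α) [SigmaFinite μ] [SigmaFinite ν] :
    ∃ p q : Measure α, p ≤ μ ∧ q ≤ ν ∧ p ⟂ₘ q ∧ p + ν = μ + q := by
  set ρ := μ + ν
  have hμ : ρ.withDensity (μ.rnDeriv ρ) = μ :=
    Measure.withDensity_rnDeriv_eq _ _ (Measure.absolutelyContinuous_of_le
      (Measure.le_add_right le_rfl))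
  have hν : ρ.withDensity (ν.rnDeriv ρ) = ν :=
    Measure.withDensity_rnDeriv_eq _ _ (Measure.absolutelyContinuous_of_le
      (Measure.le_add_left le_rfl))
  set f := μ.rnDeriv ρ
  set g := ν.rnDeriv ρ
  have hf : Measurable f := Measure.measurable_rnDeriv _ _
  have hg : Measurable g := Measure.measurable_rnDeriv _ _
  refine ⟨ρ.withDensity (f - g), ρ.withDensity (g - f), ?_, ?_, ?_, ?_⟩
  · conv_rhs => rw [← hμ]
    exact withDensity_mono (.of_forall fun x => tsub_le_self)
  · conv_rhs => rw [← hν]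
    exact withDensity_mono (.of_forall fun x => tsub_le_self)
  · have hs : MeasurableSet {x | f x ≤ g x} := measurableSet_le hf hg
    refine ⟨_, hs, ?_, ?_⟩
    · rw [withDensity_apply _ hs]
      exact setLIntegral_eq_zero hs fun x hx => tsub_eq_zero_of_le hx
    · rw [withDensity_apply _ hs.compl]
      exact setLIntegral_eq_zero hs.compl fun x hx =>
        tsub_eq_zero_of_le (lt_of_not_ge hx : g x < f x).le
  · calc ρ.withDensity (f - g) + ν = ρ.withDensity ((f - g) + g) := by
          rw [withDensity_add_right _ hg, hν]
      _ = ρ.withDensity (f + (g - f)) := by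
          congr 1
          ext x
          simp [tsub_add_eq_max, add_tsub_eq_max]
      _ = μ + ρ.withDensity (g - f) := by rw [withDensity_add_left hf, hμ]

namespace IsLevyMeasureL2

variable {μ ν : Measure SeqL2}

theorem mono (h : IsLevyMeasureL2 ν) (hle : μ ≤ ν) : IsLevyMeasureL2 μ :=
  ⟨Measure.absolutelyContinuous_of_le hle h.1, (lintegral_mono' hle le_rfl).trans_lt h.2⟩

theorem measure_lt_top (h : IsLevyMeasureL2 ν) {B : Set SeqL2} (hB : BoundedAwayFromZeroL2 B) :
    ν B < ⊤ := by
  obtain ⟨r, hr, hB⟩ := hB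
  set ε := ENNReal.ofReal (min 1 (r ^ 2))
  have hε : ε ≠ 0 := (ENNReal.ofReal_pos.2 (lt_min one_pos (by positivity))).ne'
  have hmeas : AEMeasurable (fun x : SeqL2 => ENNReal.ofReal (min 1 (‖x‖ ^ 2))) ν := by fun_prop
  refine lt_of_le_of_lt ((measure_mono fun x hx => ?_).trans
    (meas_ge_le_lintegral_div hmeas hε ENNReal.ofReal_ne_top)) (ENNReal.div_lt_top h.2.ne hε)
  have hrx : r ≤ ‖x‖ := not_lt.1 fun hlt => eq_empty_iff_forall_notMem.1 hB x ⟨hx, hlt⟩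
  exact ENNReal.ofReal_le_ofReal (by gcongr)

end IsLevyMeasureL2

/-- The complement of the ball of radius `1 / (n + 1)` around the origin. -/
def farFromZeroL2 (n : ℕ) : Set SeqL2 := {x | 1 / ((n : ℝ) + 1) ≤ ‖x‖}

theorem measurableSet_farFromZeroL2 (n : ℕ) : MeasurableSet (farFromZeroL2 n) :=
  measurableSet_le measurable_const measurable_norm

theorem boundedAwayFromZeroL2_of_subset {n : ℕ} {B : Set SeqL2} (hB : B ⊆ farFromZeroL2 n) :
    BoundedAwayFromZeroL2 B :=
  ⟨1 / ((n : ℝ) + 1), by positivity, eq_empty_of_forall_notMem fun x hx =>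
    not_lt.2 (show 1 / ((n : ℝ) + 1) ≤ ‖x‖ from hB hx.1) hx.2⟩

theorem iUnion_insert_zero_farFromZeroL2 : ⋃ n, insert 0 (farFromZeroL2 n) = univ := by
  refine eq_univ_of_forall fun x => mem_iUnion.2 ?_
  rcases eq_or_ne x 0 with rfl | hx
  · exact ⟨0, mem_insert _ _⟩
  · obtain ⟨n, hn⟩ := exists_nat_one_div_lt (norm_pos_iff.2 hx)
    exact ⟨n, mem_insert_of_mem _ hn.le⟩

theorem IsLevyMeasureL2.sigmaFinite {ν : Measure SeqL2} (h : IsLevyMeasureL2 ν) :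
    SigmaFinite ν :=
  ⟨⟨{ set := fun n => insert 0 (farFromZeroL2 n)
      set_mem := fun _ => trivial
      finite := fun n => by
        rw [insert_eq]
        refine (measure_union_le _ _).trans_lt ?_
        rw [h.1, zero_add]
        exact h.measure_lt_top (boundedAwayFromZeroL2_of_subset subset_rfl)
      spanning := iUnion_insert_zero_farFromZeroL2 }⟩⟩

/-- Measures without mass at the origin are determined by the sets bounded away from zero. -/
theorem ext_of_boundedAwayFromZeroL2 {μ ν : Measure SeqL2} (hμ : μ {0} = 0) (hν : ν {0} = 0)
    (h : ∀ B, MeasurableSet B → BoundedAwayFromZeroL2 B → μ B = ν B) : μ = ν := by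
  refine (Measure.ext_iff_of_iUnion_eq_univ iUnion_insert_zero_farFromZeroL2).2 fun n => ?_
  ext B hB
  rw [Measure.restrict_apply hB, Measure.restrict_apply hB, ← measure_sdiff_null hμ,
    ← measure_sdiff_null (s := B ∩ _) hν]
  refine h _ ((hB.inter ((measurableSet_farFromZeroL2 n).insert 0)).diff
    (measurableSet_singleton 0)) (boundedAwayFromZeroL2_of_subset (n := n) ?_)
  rintro x ⟨⟨-, hx⟩, hx0⟩
  exact hx.resolve_left hx0

/-- For Lévy measures, equality of differences away from zero is equality of sums. -/
theorem IsLevyMeasureL2.add_eq_add_iff {p q p' q' : Measure SeqL2} (hp : IsLevyMeasureL2 p)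
    (hq : IsLevyMeasureL2 q) (hp' : IsLevyMeasureL2 p') (hq' : IsLevyMeasureL2 q') :
    p + q' = p' + q ↔ ∀ B : Set SeqL2, MeasurableSet B → BoundedAwayFromZeroL2 B →
      (p B).toReal - (q B).toReal = (p' B).toReal - (q' B).toReal := by
  have key (B : Set SeqL2) (hB : BoundedAwayFromZeroL2 B) :
      (p + q') B = (p' + q) B ↔
        (p B).toReal - (q B).toReal = (p' B).toReal - (q' B).toReal := by
    have h1 := (hp.measure_lt_top hB).ne
    have h2 := (hq.measure_lt_top hB).ne
    have h3 := (hp'.measure_lt_top hB).ne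
    have h4 := (hq'.measure_lt_top hB).ne
    rw [Measure.add_apply, Measure.add_apply, sub_eq_sub_iff_add_eq_add,
      ← ENNReal.toReal_add h1 h4, ← ENNReal.toReal_add h3 h2,
      ENNReal.toReal_eq_toReal_iff' (by finiteness) (by finiteness)]
  refine ⟨fun h B _ hB => (key B hB).1 (by rw [h]), fun h => ?_⟩
  exact ext_of_boundedAwayFromZeroL2 (by simp [hp.1, hq'.1]) (by simp [hp'.1, hq.1])
    fun B hBm hB => (key B hB).2 (h B hBm hB)

/-- Given two Lévy measures `ν₁`, `ν₂` on `ℓ²`, there exists a unique pair `(ν⁺, ν⁻)` of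
mutually singular Lévy measures with `ν⁺(B) − ν⁻(B) = ν₁(B) − ν₂(B)` for every Borel set
`B` bounded away from zero. -/
theorem exists_unique_levy_pair_l2 (ν₁ ν₂ : Measure SeqL2)
    (h₁ : IsLevyMeasureL2 ν₁) (h₂ : IsLevyMeasureL2 ν₂) :
    ∃! p : Measure SeqL2 × Measure SeqL2,
      IsLevyMeasureL2 p.1 ∧ IsLevyMeasureL2 p.2 ∧ p.1 ⟂ₘ p.2 ∧
      ∀ B : Set SeqL2, MeasurableSet B → BoundedAwayFromZeroL2 B →
        (p.1 B).toReal - (p.2 B).toReal = (ν₁ B).toReal - (ν₂ B).toReal := by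
  obtain ⟨p, q, hp, hq, hpq, h⟩ :=
    haveI := h₁.sigmaFinite
    haveI := h₂.sigmaFinite
    Measure.exists_mutuallySingular_add_eq_add ν₁ ν₂
  have hp := h₁.mono hp
  have hq := h₂.mono hq
  have hdiff := (hp.add_eq_add_iff hq h₁ h₂).1 h
  refine ⟨(p, q), ⟨hp, hq, hpq, hdiff⟩, ?_⟩
  rintro ⟨p', q'⟩ ⟨hp', hq', hpq', hdiff'⟩
  have heq : p' + q = p + q' := (hp'.add_eq_add_iff hq' hp hq).2 fun B hBm hB =>
    (hdiff' B hBm hB).trans (hdiff B hBm hB).symm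
  have heq' : q' + p = q + p' := by rw [add_comm q', add_comm q, heq]
  exact Prod.ext (le_antisymm (hpq'.le_of_add_eq_add heq) (hpq.le_of_add_eq_add heq.symm))
    (le_antisymm (hpq'.symm.le_of_add_eq_add heq') (hpq.symm.le_of_add_eq_add heq'.symm))
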